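/- arXiv:2411.12160 — 8 statements merged into one kernel-verified Lean document; each statement's English description precedes it below -/
import Mathlib

section
/- Let T be a string, c a character, and suppose aub ∈ NUS(T) \ NUS(Tc), where a, b, c are characters and u is a (possibly empty) string. Then either (i) au = sqSuf(Tc) and #occ_{Tc}(au) = 2, or (ii) ub = lrSuf(Tc) and #occ_{Tc}(ub) = 2. -/
open List

/-- Number of occurrences of `w` in `T`, i.e. the number of (1-indexed) intervals
`[i..j]` with `T[i..j] = w`.  The empty string has `T.length + 1` occurrences. -/
def countOcc {α : Type*} [DecidableEq α] (T w : List α) : ℕ :=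
  ((Finset.range (T.length + 1)).filter
    (fun i => i + w.length ≤ T.length ∧ (T.drop i).take w.length = w)).card

/-- `w` is unique in `T`: it has exactly one occurrence. -/
def uniqueIn {α : Type*} [DecidableEq α] (T w : List α) : Prop := countOcc T w = 1

/-- `w` is repeating (a repeat) in `T`: it has at least two occurrences. -/
def repeatingIn {α : Type*} [DecidableEq α] (T w : List α) : Prop := 2 ≤ countOcc T w

/-- `w` is quasi-unique in `T`: it has one or two occurrences. -/
def quasiUniqueIn {α : Type*} [DecidableEq α] (T w : List α) : Prop :=
  1 ≤ countOcc T w ∧ countOcc T w ≤ 2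

/-- The (1-indexed) substring `T[i..j]`; `T[i..i-1]` is the empty string. -/
def substr {α : Type*} (T : List α) (i j : ℕ) : List α := (T.drop (i - 1)).take (j + 1 - i)

/-- `[i..j]` (1-indexed, possibly empty with `j = i - 1`) is a net occurrence in `T`:
`2 ≤ i`, `j ≤ |T| - 1`, `T[i..j]` is repeating in `T`, and both `T[i-1..j]` and
`T[i..j+1]` are unique in `T`. -/
def NetOcc {α : Type*} [DecidableEq α] (T : List α) (i j : ℕ) : Prop :=
  2 ≤ i ∧ i - 1 ≤ j ∧ j + 1 ≤ T.length ∧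
  repeatingIn T (substr T i j) ∧ uniqueIn T (substr T (i - 1) j) ∧
  uniqueIn T (substr T i (j + 1))

/-- The set of net unique substrings of `T`: the strings `T[i-1..j+1]` for net
occurrences `[i..j]`. -/
def NUS {α : Type*} [DecidableEq α] (T : List α) : Set (List α) :=
  {w | ∃ i j, NetOcc T i j ∧ w = substr T (i - 1) (j + 1)}

/-- The set of extended net occurrences of `T`: the intervals `[i-1..j+1]` for net
occurrences `[i..j]`. -/
def ENO {α : Type*} [DecidableEq α] (T : List α) : Set (ℕ × ℕ) :=
  {p | 1 ≤ p.2 ∧ NetOcc T (p.1 + 1) (p.2 - 1)}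

/-- The set of minimal unique substring (MUS) occurrences `[i..j]` in `T`:
`T[i..j]` is unique in `T` while `T[i+1..j]` and `T[i..j-1]` are repeating in `T`. -/
def MUS {α : Type*} [DecidableEq α] (T : List α) : Set (ℕ × ℕ) :=
  {p | 1 ≤ p.1 ∧ p.1 ≤ p.2 ∧ p.2 ≤ T.length ∧ uniqueIn T (substr T p.1 p.2) ∧
       repeatingIn T (substr T (p.1 + 1) p.2) ∧ repeatingIn T (substr T p.1 (p.2 - 1))}

/-- `w` is the longest repeating suffix `lrSuf(T)` of `T`. -/
def IsLrSuf {α : Type*} [DecidableEq α] (T w : List α) : Prop :=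
  w <:+ T ∧ repeatingIn T w ∧ ∀ v, v <:+ T → repeatingIn T v → v.length ≤ w.length

/-- `w` is the shortest quasi-unique suffix `sqSuf(T)` of `T`. -/
def IsSqSuf {α : Type*} [DecidableEq α] (T w : List α) : Prop :=
  w <:+ T ∧ quasiUniqueIn T w ∧ ∀ v, v <:+ T → quasiUniqueIn T v → w.length ≤ v.length

/-- `w` is the longest repeating prefix `lrPref(T)` of `T`. -/
def IsLrPref {α : Type*} [DecidableEq α] (T w : List α) : Prop :=
  w <+: T ∧ repeatingIn T w ∧ ∀ v, v <+: T → repeatingIn T v → v.length ≤ w.length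

/-- `w` is the shortest quasi-unique prefix `sqPref(T)` of `T`. -/
def IsSqPref {α : Type*} [DecidableEq α] (T w : List α) : Prop :=
  w <+: T ∧ quasiUniqueIn T w ∧ ∀ v, v <+: T → quasiUniqueIn T v → w.length ≤ v.length

/-- The finset of occurrence positions counted by `countOcc`. -/
def occSet {α : Type*} [DecidableEq α] (T w : List α) : Finset ℕ :=
  ((Finset.range (T.length + 1)).filter
    (fun i => i + w.length ≤ T.length ∧ (T.drop i).take w.length = w))

theorem countOcc_eq {α : Type*} [DecidableEq α] (T w : List α) :
    countOcc T w = (occSet T w).card := rfl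

theorem mem_occSet {α : Type*} [DecidableEq α] (T w : List α) (i : ℕ) :
    i ∈ occSet T w ↔ ∃ p s, p.length = i ∧ T = p ++ (w ++ s) := by
  simp only [occSet, Finset.mem_filter, Finset.mem_range]
  constructor
  · rintro ⟨_, h2, h3⟩
    refine ⟨T.take i, (T.drop i).drop w.length, by simp; omega, ?_⟩
    have h := List.take_append_drop w.length (T.drop i)
    rw [h3] at h
    rw [h, List.take_append_drop]
  · rintro ⟨p, s, rfl, rfl⟩
    refine ⟨by simp, by simp, by simp⟩

theorem occ_unique {α : Type*} [DecidableEq α] {T w : List α} (h : uniqueIn T w)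
    {p s p' s' : List α} (h1 : T = p ++ (w ++ s)) (h2 : T = p' ++ (w ++ s')) :
    p.length = p'.length := by
  have hc : (occSet T w).card = 1 := h
  exact Finset.card_le_one.mp hc.le _ ((mem_occSet _ _ _).2 ⟨p, s, rfl, h1⟩) _
    ((mem_occSet _ _ _).2 ⟨p', s', rfl, h2⟩)

theorem occ_exists {α : Type*} [DecidableEq α] {T w : List α} (h : 1 ≤ countOcc T w) :
    ∃ p s, T = p ++ (w ++ s) := by
  rw [countOcc_eq] at h
  obtain ⟨i, hi⟩ := Finset.card_pos.mp h
  obtain ⟨p, s, _, h⟩ := (mem_occSet _ _ _).1 hi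
  exact ⟨p, s, h⟩

theorem occSet_mono {α : Type*} [DecidableEq α] (T w : List α) (c : α) :
    occSet T w ⊆ occSet (T ++ [c]) w := by
  intro i hi
  obtain ⟨p, s, h, h'⟩ := (mem_occSet _ _ _).1 hi
  exact (mem_occSet _ _ _).2 ⟨p, s ++ [c], h, by simp [h']⟩

theorem occSet_last {α : Type*} [DecidableEq α] (T w : List α) (c : α) (i : ℕ)
    (hi : i ∈ occSet (T ++ [c]) w) (hn : i ∉ occSet T w) :
    ∃ p, p.length = i ∧ T ++ [c] = p ++ w := by
  obtain ⟨p, s, h, h'⟩ := (mem_occSet _ _ _).1 hi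
  rcases List.eq_nil_or_concat s with rfl | ⟨s', d, rfl⟩
  · exact ⟨p, h, by simpa using h'⟩
  · exfalso
    apply hn
    refine (mem_occSet _ _ _).2 ⟨p, s', h, ?_⟩
    have h2 : T ++ [c] = (p ++ (w ++ s')) ++ [d] := by simpa using h'
    exact (List.append_inj' h2 rfl).1

theorem count_suffix {α : Type*} [DecidableEq α] (T w : List α) (c : α)
    (h : w <:+ T ++ [c]) : countOcc (T ++ [c]) w = countOcc T w + 1 := by
  obtain ⟨p, hp⟩ := h
  have hni : p.length ∉ occSet T w := by
    intro hm
    obtain ⟨q, s, h1, h2⟩ := (mem_occSet _ _ _).1 hm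
    have e1 := congrArg List.length hp
    have e2 := congrArg List.length h2
    simp at e1 e2
    omega
  have : occSet (T ++ [c]) w = insert p.length (occSet T w) := by
    ext i
    rw [Finset.mem_insert]
    constructor
    · intro hi
      by_cases hn : i ∈ occSet T w
      · exact Or.inr hn
      · left
        obtain ⟨q, h1, h2⟩ := occSet_last T w c i hi hn
        have e1 := congrArg List.length hp
        have e2 := congrArg List.length h2
        simp at e1 e2
        omega
    · rintro (rfl | hi)
      · exact (mem_occSet _ _ _).2 ⟨p, [], rfl, by simp [hp]⟩
      · exact occSet_mono T w c hi
  rw [countOcc_eq, countOcc_eq, this, Finset.card_insert_of_notMem hni]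

theorem count_not_suffix {α : Type*} [DecidableEq α] (T w : List α) (c : α)
    (h : ¬ w <:+ T ++ [c]) : countOcc (T ++ [c]) w = countOcc T w := by
  have : occSet (T ++ [c]) w = occSet T w := by
    apply Finset.Subset.antisymm _ (occSet_mono T w c)
    intro i hi
    by_contra hn
    obtain ⟨q, h1, h2⟩ := occSet_last T w c i hi hn
    exact h ⟨q, h2.symm⟩
  rw [countOcc_eq, countOcc_eq, this]

theorem count_anti {α : Type*} [DecidableEq α] (T v w : List α)
    (h : v <:+ w) : countOcc T w ≤ countOcc T v := by
  obtain ⟨x, rfl⟩ := h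
  rw [countOcc_eq, countOcc_eq]
  apply Finset.card_le_card_of_injOn (fun i => i + x.length)
  · intro i hi
    obtain ⟨p, s, h1, h2⟩ := (mem_occSet _ _ _).1 hi
    exact (mem_occSet _ _ _).2 ⟨p ++ x, s, by simp [h1], by simp [h2]⟩
  · intro i _ j _ hij
    simpa using hij

theorem mem_NUS_iff {α : Type*} [DecidableEq α] (T : List α) (a b : α) (u : List α) :
    (a :: u ++ [b]) ∈ NUS T ↔ (∃ p s, T = p ++ (a :: u ++ [b] ++ s)) ∧ repeatingIn T u ∧
      uniqueIn T (a :: u) ∧ uniqueIn T (u ++ [b]) := by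
  have key : ∀ p s : List α, T = p ++ (a :: u ++ [b] ++ s) →
      substr T (p.length + 2) (p.length + 1 + u.length) = u ∧
      substr T (p.length + 2 - 1) (p.length + 1 + u.length) = a :: u ∧
      substr T (p.length + 2) (p.length + 1 + u.length + 1) = u ++ [b] ∧
      substr T (p.length + 2 - 1) (p.length + 1 + u.length + 1) = a :: u ++ [b] := by
    rintro p s rfl
    have e1 : (p ++ (a :: u ++ [b] ++ s)).drop (p.length + 1) = u ++ ([b] ++ s) := by
      have : p ++ (a :: u ++ [b] ++ s) = (p ++ [a]) ++ (u ++ ([b] ++ s)) := by simp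
      rw [this]
      exact List.drop_left' (by simp)
    have e2 : (p ++ (a :: u ++ [b] ++ s)).drop p.length = a :: u ++ [b] ++ s :=
      List.drop_left' rfl
    unfold substr
    refine ⟨?_, ?_, ?_, ?_⟩
    · rw [show p.length + 2 - 1 = p.length + 1 by omega, e1]
      exact List.take_left' (by omega)
    · rw [show p.length + 2 - 1 - 1 = p.length by omega, e2,
        show a :: u ++ [b] ++ s = (a :: u) ++ ([b] ++ s) by simp]
      exact List.take_left' (by simp; omega)
    · rw [show p.length + 2 - 1 = p.length + 1 by omega, e1, ← List.append_assoc]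
      exact List.take_left' (by simp; omega)
    · rw [show p.length + 2 - 1 - 1 = p.length by omega, e2]
      exact List.take_left' (by simp; omega)
  constructor
  · rintro ⟨i, j, ⟨hi, hij, hj, hr, hu1, hu2⟩, hw⟩
    have hT : T = T.take (i - 2) ++ (a :: u ++ [b] ++ (T.drop (i - 2)).drop (j + 3 - i)) := by
      rw [hw]
      unfold substr
      rw [show i - 1 - 1 = i - 2 by omega, show j + 1 + 1 - (i - 1) = j + 3 - i by omega,
        List.take_append_drop, List.take_append_drop]
    have hlen := congrArg List.length hw
    simp [substr] at hlen
    have hp : (T.take (i - 2)).length = i - 2 := by simp; omega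
    obtain ⟨k1, k2, k3, k4⟩ := key _ _ hT
    rw [hp] at k1 k2 k3 k4
    have hi' : i - 2 + 2 = i := by omega
    have hj' : i - 2 + 1 + u.length = j := by omega
    rw [hi', hj'] at k1 k2 k3 k4
    rw [k1] at hr
    rw [k2] at hu1
    rw [k3] at hu2
    exact ⟨⟨_, _, hT⟩, hr, hu1, hu2⟩
  · rintro ⟨⟨p, s, hT⟩, hr, hu1, hu2⟩
    obtain ⟨k1, k2, k3, k4⟩ := key _ _ hT
    refine ⟨p.length + 2, p.length + 1 + u.length, ⟨by omega, by omega, ?_, ?_, ?_, ?_⟩, k4.symm⟩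
    · have := congrArg List.length hT
      simp at this
      omega
    · rwa [k1]
    · rwa [k2]
    · rwa [k3]

/-- If `aub ∈ NUS(T) \ NUS(Tc)`, then (i) `au = sqSuf(Tc)` and `#occ_{Tc}(au) = 2`, or
(ii) `ub = lrSuf(Tc)` and `#occ_{Tc}(ub) = 2`. -/
theorem deleted_net_occurrence {α : Type*} [DecidableEq α] (T : List α) (a b c : α)
    (u : List α) (h1 : (a :: u ++ [b]) ∈ NUS T) (h2 : (a :: u ++ [b]) ∉ NUS (T ++ [c])) :
    (IsSqSuf (T ++ [c]) (a :: u) ∧ countOcc (T ++ [c]) (a :: u) = 2) ∨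
    (IsLrSuf (T ++ [c]) (u ++ [b]) ∧ countOcc (T ++ [c]) (u ++ [b]) = 2) := by
  rw [mem_NUS_iff] at h1 h2
  obtain ⟨⟨p, s, hT⟩, hr, hu1, hu2⟩ := h1
  by_cases hA : (a :: u) <:+ T ++ [c]
  · left
    have hc := count_suffix T _ c hA
    rw [show countOcc T (a :: u) = 1 from hu1] at hc
    refine ⟨⟨hA, ⟨by omega, by omega⟩, ?_⟩, hc⟩
    intro v hv hq
    by_contra hlt
    have hu : u <:+ T ++ [c] := (List.suffix_cons a u).trans hA
    have hvu : v <:+ u := List.suffix_of_suffix_length_le hv hu (by simp at hlt; omega)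
    have h3 := count_anti (T ++ [c]) v u hvu
    have h4 := count_suffix T u c hu
    have h5 := hq.2
    have h6 : 2 ≤ countOcc T u := hr
    omega
  by_cases hB : (u ++ [b]) <:+ T ++ [c]
  · right
    have hc := count_suffix T _ c hB
    rw [show countOcc T (u ++ [b]) = 1 from hu2] at hc
    refine ⟨⟨hB, hc.ge, ?_⟩, hc⟩
    intro v hv hq
    by_contra hlt
    obtain ⟨x', hx'⟩ := List.suffix_of_suffix_length_le hB hv (by omega)
    rcases List.eq_nil_or_concat x' with rfl | ⟨x, y, rfl⟩
    · subst hx'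
      simp at hlt
    have h3 := count_suffix T v c hv
    have h4 : 2 ≤ countOcc (T ++ [c]) v := hq
    obtain ⟨p', s', hT'⟩ := occ_exists (T := T) (w := v) (by omega)
    have hd1 : T = (p ++ [a]) ++ ((u ++ [b]) ++ s) := by simp [hT]
    have hd2 : T = (p' ++ x ++ [y]) ++ ((u ++ [b]) ++ s') := by
      rw [hT', ← hx']; simp
    have hl := occ_unique hu2 hd1 hd2
    have he := (List.append_inj (hd1.symm.trans hd2) hl).1
    have hay : a = y := by
      have := (List.append_inj' he rfl).2
      simpa using this
    subst hay
    obtain ⟨q, hq'⟩ := hv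
    have h5 : (q ++ x ++ (a :: u)) ++ [b] = T ++ [c] := by
      rw [← hq', ← hx']; simp
    have h6 := (List.append_inj' h5 rfl).1
    have h7 := occ_unique hu1 (p := q ++ x) (s := []) (p' := p) (s' := [b] ++ s)
      (by simp [← h6]) (by simp [hT])
    have e1 := congrArg List.length h6
    have e2 := congrArg List.length hT
    simp at e1 e2 h7
    omega
  · exfalso
    apply h2
    refine ⟨⟨p, s ++ [c], by simp [hT]⟩, ?_, ?_, ?_⟩
    · exact le_trans hr (Finset.card_le_card (occSet_mono T u c))
    · exact (count_not_suffix T _ c hA).trans hu1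
    · exact (count_not_suffix T _ c hB).trans hu2
end

section
/- Let T be a string, c a character, and suppose aub ∈ NUS(T), where a, b are characters and u is a (possibly empty) string. Then au and ub are not both repeating in Tc; i.e., it is impossible that #occ_{Tc}(au) ≥ 2 and #occ_{Tc}(ub) ≥ 2 simultaneously. -/
open List

theorem suffix_of_unique_of_repeating {α : Type*} [DecidableEq α] (T w : List α) (c : α)
    (hu : uniqueIn T w) (hr : repeatingIn (T ++ [c]) w) :
    (T ++ [c]).drop (T.length + 1 - w.length) = w := by
  by_contra hne
  unfold uniqueIn at hu
  unfold repeatingIn at hr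
  have hle : countOcc (T ++ [c]) w ≤ countOcc T w := by
    unfold countOcc
    apply Finset.card_le_card
    intro i hi
    simp only [Finset.mem_filter, Finset.mem_range, List.length_append, List.length_cons,
      List.length_nil] at hi ⊢
    obtain ⟨h0, h1, h2⟩ := hi
    by_cases h : i + w.length ≤ T.length
    · refine ⟨by omega, h, ?_⟩
      rw [List.drop_append_of_le_length (by omega),
        List.take_append_of_le_length (by simp; omega)] at h2
      exact h2
    · exfalso
      apply hne
      have hi' : i = T.length + 1 - w.length := by omega
      rw [← hi']
      rwa [List.take_of_length_le (by simp; omega)] at h2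
  omega

theorem eq_of_unique_of_mem {α : Type*} [DecidableEq α] (T w : List α) (hu : uniqueIn T w)
    (p q : ℕ) (hp : p + w.length ≤ T.length) (hq : q + w.length ≤ T.length)
    (hp' : (T.drop p).take w.length = w) (hq' : (T.drop q).take w.length = w) : p = q := by
  unfold uniqueIn countOcc at hu
  refine Finset.card_le_one.mp hu.le p ?_ q ?_
  · simp only [Finset.mem_filter, Finset.mem_range]
    exact ⟨by omega, hp, hp'⟩
  · simp only [Finset.mem_filter, Finset.mem_range]
    exact ⟨by omega, hq, hq'⟩

/-- If `aub ∈ NUS(T)`, then `au` and `ub` cannot both be repeating in `Tc`. -/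
theorem not_both_repeating {α : Type*} [DecidableEq α] (T : List α) (a b c : α)
    (u : List α) (h1 : (a :: u ++ [b]) ∈ NUS T) :
    ¬ (repeatingIn (T ++ [c]) (a :: u) ∧ repeatingIn (T ++ [c]) (u ++ [b])) := by
  rintro ⟨hr1, hr2⟩
  obtain ⟨i, j, ⟨hi, hij, hj, -, hu1, hu2⟩, hw⟩ := h1
  obtain ⟨p, rfl⟩ : ∃ p, i = p + 2 := ⟨i - 2, by omega⟩
  have hlen := congrArg List.length hw
  simp only [substr, List.length_append, List.length_cons, List.length_nil, List.length_take,
    List.length_drop] at hlen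
  obtain rfl : j = p + 1 + u.length := by omega
  have hw' : (T.drop p).take (u.length + 2) = a :: u ++ [b] := by
    rw [hw, substr]
    congr 1
    omega
  have e1 : (T.drop p).take (u.length + 1) = a :: u := by
    have := congrArg (List.take (u.length + 1)) hw'
    rw [List.take_take, List.take_append_of_le_length (by simp)] at this
    simpa using this
  have e2 : (T.drop (p + 1)).take (u.length + 1) = u ++ [b] := by
    have := congrArg (List.drop 1) hw'
    rw [List.drop_take, List.drop_drop] at this
    simpa using this
  have s1 : substr T (p + 2 - 1) (p + 1 + u.length) = a :: u := by
    rw [← e1, substr]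
    congr 1
    omega
  have s2 : substr T (p + 2) (p + 1 + u.length + 1) = u ++ [b] := by
    rw [← e2, substr]
    congr 1
    omega
  rw [s1] at hu1
  rw [s2] at hu2
  have f1 := suffix_of_unique_of_repeating T _ c hu1 hr1
  have f2 := suffix_of_unique_of_repeating T _ c hu2 hr2
  have hl : (u ++ [b]).length = (a :: u).length := by simp
  rw [hl, f1] at f2
  rw [← f2] at e2
  have := eq_of_unique_of_mem T (a :: u) hu1 p (p + 1) (by simp; omega) (by simp; omega)
    (by simpa using e1) (by simpa using e2)
  omega
end

section
/- Let T be a string, c a character, and suppose cua ∈ NUS(cT) \ NUS(T) is a net unique substring of cT that is a prefix of cT, where a, c are characters and u is a (possibly empty) string. Then either (i) u = lrPref(T), or (ii) u = c^exp and #occ_T(u) = 1, where exp = max{e : c^e is a prefix of T}. -/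
open List

/-- `w` occurs in `T` at (0-indexed) position `i`. -/
def OccAt {α : Type*} (T w : List α) (i : ℕ) : Prop :=
  i ≤ T.length ∧ w <+: T.drop i

theorem mem_occ_iff {α : Type*} [DecidableEq α] (T w : List α) (i : ℕ) :
    i ∈ ((Finset.range (T.length + 1)).filter
      (fun i => i + w.length ≤ T.length ∧ (T.drop i).take w.length = w)) ↔ OccAt T w i := by
  simp only [Finset.mem_filter, Finset.mem_range, OccAt]
  constructor
  · rintro ⟨_, h, h'⟩
    exact ⟨by omega, by rw [← h']; exact List.take_prefix _ _⟩
  · rintro ⟨h, h'⟩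
    have := h'.length_le
    rw [List.length_drop] at this
    exact ⟨by omega, by omega, (List.prefix_iff_eq_take.mp h').symm⟩

theorem uniqueIn.eq {α : Type*} [DecidableEq α] {T w : List α} (h : uniqueIn T w) {i j : ℕ}
    (hi : OccAt T w i) (hj : OccAt T w j) : i = j := by
  unfold uniqueIn countOcc at h
  rw [← mem_occ_iff] at hi hj
  exact Finset.card_le_one.mp h.le i hi j hj

theorem repeatingIn.exists_occ {α : Type*} [DecidableEq α] {T w : List α}
    (h : repeatingIn T w) : ∃ i j, OccAt T w i ∧ OccAt T w j ∧ i ≠ j := by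
  unfold repeatingIn countOcc at h
  obtain ⟨i, hi, j, hj, hij⟩ := Finset.one_lt_card.mp h
  exact ⟨i, j, (mem_occ_iff ..).mp hi, (mem_occ_iff ..).mp hj, hij⟩

theorem repeatingIn_of_occ {α : Type*} [DecidableEq α] {T w : List α} {i j : ℕ}
    (hi : OccAt T w i) (hj : OccAt T w j) (hij : i ≠ j) : repeatingIn T w := by
  rw [← mem_occ_iff] at hi hj
  exact Finset.one_lt_card.mpr ⟨i, hi, j, hj, hij⟩

theorem countOcc_pos_of_occ {α : Type*} [DecidableEq α] {T w : List α} {i : ℕ}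
    (hi : OccAt T w i) : 1 ≤ countOcc T w := by
  rw [← mem_occ_iff] at hi
  exact Finset.card_pos.mpr ⟨i, hi⟩

theorem occAt_cons_succ {α : Type*} (T w : List α) (c : α) (i : ℕ) :
    OccAt (c :: T) w (i + 1) ↔ OccAt T w i := by
  simp [OccAt]

theorem nus_decomp {α : Type*} [DecidableEq α] (S u : List α) (a c : α)
    (h : (c :: u ++ [a]) ∈ NUS S) :
    repeatingIn S u ∧ uniqueIn S (c :: u) ∧ uniqueIn S (u ++ [a]) := by
  obtain ⟨i, j, ⟨hi, hij, hj, hr, hu1, hu2⟩, hw⟩ := h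
  obtain ⟨p, rfl⟩ : ∃ p, i = p + 2 := ⟨i - 2, by omega⟩
  obtain ⟨k, rfl⟩ : ∃ k, j = p + 1 + k := ⟨j - (p + 1), by omega⟩
  unfold substr at *
  have e1 : p + 2 - 1 = 1 + p := by omega
  have e2 : 1 + p - 1 = p := by omega
  have e3 : p + 1 + k + 1 - (p + 2) = k := by omega
  have e4 : p + 1 + k + 1 - (1 + p) = k + 1 := by omega
  have e5 : p + 1 + k + 1 + 1 - (p + 2) = k + 1 := by omega
  have e6 : p + 1 + k + 1 + 1 - (1 + p) = k + 2 := by omega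
  rw [e1, e3, Nat.add_comm, ← List.drop_drop] at hr
  rw [e1, e2, e4] at hu1
  rw [e1, e5, Nat.add_comm 1 p, ← List.drop_drop] at hu2
  rw [e1, e2, e6] at hw
  have hl := congrArg List.length hw
  simp at hl
  have hk : k = u.length := by omega
  have hp : (c :: u ++ [a]) <+: S.drop p := by rw [hw]; exact List.take_prefix _ _
  obtain ⟨R, hR⟩ := hp
  rw [← hR] at hr hu1 hu2
  subst hk
  simp at hr hu1 hu2
  refine ⟨hr, hu1, ?_⟩
  have e : List.take (u.length + 1) u = u := List.take_of_length_le (by omega)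
  simpa [List.take_append, e] using hu2

theorem eq_replicate_of_prefix {α : Type*} (c : α) (u T : List α)
    (h1 : u <+: T) (h2 : u <+: c :: T) : u = List.replicate u.length c := by
  induction u generalizing T with
  | nil => rfl
  | cons x u ih =>
    obtain ⟨hx, h3⟩ := List.cons_prefix_cons.mp h2
    subst hx
    obtain ⟨T, rfl⟩ : ∃ T', T = x :: T' := by
      cases T with
      | nil => simp at h1
      | cons y T => exact ⟨T, by rw [(List.cons_prefix_cons.mp h1).1]⟩
    have h1 := (List.cons_prefix_cons.mp h1).2
    rw [List.length_cons, List.replicate_succ, ← ih T h1 h3]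

/-- If `cua ∈ NUS(cT) \ NUS(T)` is a prefix of `cT`, then (i) `u = lrPref(T)`, or
(ii) `u = c^exp` and `#occ_T(u) = 1`, where `exp = max{e : c^e is a prefix of T}`. -/
theorem added_net_occurrence_prefix {α : Type*} [DecidableEq α] (T : List α)
    (a c : α) (u : List α) (exp : ℕ)
    (hexp1 : List.replicate exp c <+: T) (hexp2 : ∀ e, List.replicate e c <+: T → e ≤ exp)
    (h1 : (c :: u ++ [a]) ∈ NUS (c :: T)) (h2 : (c :: u ++ [a]) ∉ NUS T)
    (h3 : (c :: u ++ [a]) <+: (c :: T)) :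
    IsLrPref T u ∨ (u = List.replicate exp c ∧ countOcc T u = 1) := by
  obtain ⟨hr, hu1, hu2⟩ := nus_decomp _ _ _ _ h1
  have hua : (u ++ [a]) <+: T := (List.cons_prefix_cons.mp h3).2
  have hu : u <+: T := (List.prefix_append _ _).trans hua
  have hu0 : OccAt T u 0 := ⟨Nat.zero_le _, hu⟩
  by_cases hrep : repeatingIn T u
  · left
    refine ⟨hu, hrep, fun v hv hvr => ?_⟩
    by_contra hlt
    have hpre : (u ++ [a]) <+: v := List.prefix_of_prefix_length_le hua hv (by simp; omega)
    obtain ⟨i, j, hi, hj, hij⟩ := hvr.exists_occ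
    have hi' : OccAt (c :: T) (u ++ [a]) (i + 1) :=
      (occAt_cons_succ ..).mpr ⟨hi.1, hpre.trans hi.2⟩
    have hj' : OccAt (c :: T) (u ++ [a]) (j + 1) :=
      (occAt_cons_succ ..).mpr ⟨hj.1, hpre.trans hj.2⟩
    have := hu2.eq hi' hj'
    omega
  · right
    have hone : countOcc T u = 1 := by
      have := countOcc_pos_of_occ hu0
      unfold repeatingIn at hrep
      omega
    refine ⟨?_, hone⟩
    have hc : u <+: c :: T := by
      obtain ⟨i, j, hi, hj, hij⟩ := hr.exists_occ
      rcases i with _ | i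
      · exact hi.2
      rcases j with _ | j
      · exact hj.2
      exact absurd (repeatingIn_of_occ ((occAt_cons_succ ..).mp hi)
        ((occAt_cons_succ ..).mp hj) (by omega)) hrep
    have hk := eq_replicate_of_prefix c u T hu hc
    have hle : u.length ≤ exp := hexp2 _ (hk ▸ hu)
    have hge : ¬ u.length + 1 ≤ exp := by
      intro hlt
      have hcu : (c :: u) <+: T := by
        refine List.IsPrefix.trans ?_ hexp1
        rw [hk, ← List.replicate_succ]
        exact ⟨List.replicate (exp - (u.length + 1)) c, by
          rw [List.replicate_append_replicate]; congr 1; omega⟩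
      have o0 : OccAt (c :: T) (c :: u) 0 :=
        ⟨Nat.zero_le _, List.cons_prefix_cons.mpr ⟨rfl, hu⟩⟩
      have o1 : OccAt (c :: T) (c :: u) (0 + 1) :=
        (occAt_cons_succ ..).mpr ⟨Nat.zero_le _, hcu⟩
      have := hu1.eq o0 o1
      omega
    have : u.length = exp := by omega
    rw [← this]
    exact hk
end

section
/- Let T be a string of length n > 2 and c a character. Then −1 ≤ #ENO(Tc) − #ENO(T) ≤ 2; in particular, #ENO(Tc) − #ENO(T) ≠ −2. -/
open List

/-- `T[l..r)` (0-indexed, half open) occurs only at position `l`. -/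
def UU {α : Type*} (T : List α) (l r : ℕ) : Prop :=
  ∀ i, i + (r - l) ≤ T.length → (∀ k, k < r - l → T[i + k]? = T[l + k]?) → i = l

theorem UU_mono {α : Type*} {T : List α} {l r l' r' : ℕ} (h : UU T l r) (hl : l' ≤ l)
    (hlr : l ≤ r) (hr : r ≤ r') : UU T l' r' := by
  intro i hi hk
  have := h (i + (l - l')) (by omega) (fun k hk' => by
    have := hk (l - l' + k) (by omega)
    rw [show i + (l - l') + k = i + (l - l' + k) by omega, this]
    congr 1; omega)
  omega

theorem UU_full {α : Type*} (T : List α) : UU T 0 T.length := by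
  intro i hi _; omega

theorem not_UU_empty {α : Type*} {T : List α} (hn : 0 < T.length) (l : ℕ) : ¬ UU T l l := by
  intro h
  have h0 := h 0 (by omega) (by intro k hk; omega)
  have h1 := h 1 (by omega) (by intro k hk; omega)
  omega

theorem occ_iff {α : Type*} (T : List α) (l r i : ℕ) (hlr : l ≤ r) (hr : r ≤ T.length)
    (hi : i + (r - l) ≤ T.length) :
    ((T.drop i).take (r - l) = (T.drop l).take (r - l)) ↔
      ∀ k, k < r - l → T[i + k]? = T[l + k]? := by
  constructor
  · intro h k hk
    have := congrArg (fun L => L[k]?) h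
    simpa [List.getElem?_take, hk] using this
  · intro h
    apply List.ext_getElem?
    intro k
    by_cases hk : k < r - l
    · simpa [List.getElem?_take, hk] using h k hk
    · simp [List.getElem?_take, hk]

theorem count_aux {α : Type*} [DecidableEq α] (T : List α) (l r : ℕ) (hlr : l ≤ r)
    (hr : r ≤ T.length) :
    1 ≤ countOcc T ((T.drop l).take (r - l)) ∧
    (countOcc T ((T.drop l).take (r - l)) = 1 ↔ UU T l r) := by
  unfold countOcc
  have hlen : ((T.drop l).take (r - l)).length = r - l := by
    simp; omega
  rw [hlen]
  set S := (Finset.range (T.length + 1)).filter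
    (fun i => i + (r - l) ≤ T.length ∧ (T.drop i).take (r - l) = (T.drop l).take (r - l)) with hS
  have hmem : l ∈ S := by
    simp only [hS, Finset.mem_filter, Finset.mem_range]
    refine ⟨by omega, by omega, trivial⟩
  refine ⟨Finset.card_pos.mpr ⟨l, hmem⟩, ?_⟩
  constructor
  · intro h i hi hk
    obtain ⟨a, ha⟩ := Finset.card_eq_one.mp h
    have hiS : i ∈ S := by
      simp only [hS, Finset.mem_filter, Finset.mem_range]
      exact ⟨by omega, hi, (occ_iff T l r i hlr hr hi).mpr hk⟩
    rw [ha, Finset.mem_singleton] at hmem hiS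
    rw [hmem, hiS]
  · intro h
    rw [Finset.card_eq_one]
    refine ⟨l, ?_⟩
    ext i
    rw [Finset.mem_singleton]
    constructor
    · intro hi
      simp only [hS, Finset.mem_filter, Finset.mem_range] at hi
      exact h i hi.2.1 ((occ_iff T l r i hlr hr hi.2.1).mp hi.2.2)
    · rintro rfl; exact hmem

theorem mem_ENO {α : Type*} [DecidableEq α] (T : List α) (l r : ℕ) :
    (l, r) ∈ ENO T ↔ 1 ≤ l ∧ l < r ∧ r ≤ T.length ∧ ¬ UU T l (r - 1) ∧ UU T (l - 1) (r - 1) ∧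
      UU T l r := by
  simp only [ENO, NetOcc, Set.mem_setOf_eq, substr, repeatingIn, uniqueIn]
  constructor
  · rintro ⟨h1, h2, h3, h4, h5, h6, h7⟩
    have e1 := count_aux T l (r - 1) (by omega) (by omega)
    have e2 := count_aux T (l - 1) (r - 1) (by omega) (by omega)
    have e3 := count_aux T l r (by omega) (by omega)
    rw [show r - 1 + 1 - (l + 1) = r - 1 - l by omega, show l + 1 - 1 = l by omega] at h5
    rw [show r - 1 + 1 - (l + 1 - 1) = r - 1 - (l - 1) by omega,
      show l + 1 - 1 - 1 = l - 1 by omega] at h6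
    rw [show r - 1 + 1 + 1 - (l + 1) = r - l by omega, show l + 1 - 1 = l by omega] at h7
    refine ⟨by omega, by omega, by omega, ?_, e2.2.mp h6, e3.2.mp h7⟩
    rw [← e1.2]; omega
  · rintro ⟨h1, h2, h3, h5, h6, h7⟩
    have e1 := count_aux T l (r - 1) (by omega) (by omega)
    have e2 := count_aux T (l - 1) (r - 1) (by omega) (by omega)
    have e3 := count_aux T l r (by omega) (by omega)
    rw [show r - 1 + 1 - (l + 1) = r - 1 - l by omega, show l + 1 - 1 = l by omega,
      show r - 1 + 1 - l = r - 1 - (l - 1) by omega,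
      show r - 1 + 1 + 1 - (l + 1) = r - l by omega]
    refine ⟨by omega, by omega, by omega, by omega, ?_, e2.2.mpr h6, e3.2.mpr h7⟩
    rw [← e1.2] at h5; omega

/-- The set of right ends of minimal unique substrings. -/
def VV {α : Type*} (T : List α) : Set ℕ :=
  {r | r ≤ T.length ∧ ∃ l, l < r ∧ UU T l r ∧ ¬ UU T l (r - 1)}

theorem VV_finite {α : Type*} (T : List α) : (VV T).Finite :=
  (Set.finite_Iic T.length).subset (fun _ h => h.1)

theorem VV_ncard {α : Type*} [DecidableEq α] (T : List α) (hn : 0 < T.length) :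
    (VV T).ncard = (ENO T).ncard + 1 := by
  classical
  have hex : ∃ r, UU T 0 r := ⟨_, UU_full T⟩
  obtain ⟨r0, hr0, hmin⟩ : ∃ r, UU T 0 r ∧ ∀ s, s < r → ¬ UU T 0 s :=
    ⟨Nat.find hex, Nat.find_spec hex, fun s hs => Nat.find_min hex hs⟩
  have hr0n : r0 ≤ T.length := by
    by_contra h
    exact hmin _ (not_le.mp h) (UU_full T)
  have hr0p : 0 < r0 := by
    rcases Nat.eq_zero_or_pos r0 with h | h
    · subst h; exact absurd hr0 (not_UU_empty hn 0)
    · exact h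
  have hinj : Set.InjOn Prod.snd (ENO T) := by
    rintro ⟨l1, r⟩ h1 ⟨l2, r2⟩ h2 h
    simp only at h
    subst h
    rw [mem_ENO] at h1 h2
    obtain ⟨a1, a2, a3, a4, a5, a6⟩ := h1
    obtain ⟨b1, b2, b3, b4, b5, b6⟩ := h2
    rcases lt_trichotomy l1 l2 with h | h | h
    · exact absurd (UU_mono b5 (by omega) (by omega) le_rfl) a4
    · rw [h]
    · exact absurd (UU_mono a5 (by omega) (by omega) le_rfl) b4
  have hV : VV T = insert r0 (Prod.snd '' ENO T) := by
    ext r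
    constructor
    · rintro ⟨hr, hl⟩
      obtain ⟨l, ⟨hlr, hu, hnu⟩, hm⟩ : ∃ l, (l < r ∧ UU T l r ∧ ¬ UU T l (r - 1)) ∧
          ∀ s, s < l → ¬ (s < r ∧ UU T s r ∧ ¬ UU T s (r - 1)) :=
        ⟨Nat.find hl, Nat.find_spec hl, fun s hs => Nat.find_min hl hs⟩
      rcases Nat.eq_zero_or_pos l with h | h
      · subst h
        left
        rcases lt_trichotomy r r0 with h | h | h
        · exact absurd hu (hmin _ h)
        · exact h
        · exact absurd (UU_mono hr0 le_rfl (by omega) (by omega)) hnu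
      · right
        refine ⟨(l, r), ?_, rfl⟩
        rw [mem_ENO]
        refine ⟨h, hlr, hr, hnu, ?_, hu⟩
        by_contra hc
        exact hm (l - 1) (by omega) ⟨by omega, UU_mono hu (by omega) (by omega) le_rfl, hc⟩
    · rintro (rfl | ⟨⟨l, r'⟩, h, rfl⟩)
      · exact ⟨hr0n, 0, hr0p, hr0, hmin _ (by omega)⟩
      · rw [mem_ENO] at h
        exact ⟨h.2.2.1, l, h.2.1, h.2.2.2.2.2, h.2.2.2.1⟩
  have hnot : r0 ∉ Prod.snd '' ENO T := by
    rintro ⟨⟨l, r'⟩, h, rfl⟩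
    rw [mem_ENO] at h
    simp only at *
    exact hmin (r' - 1) (by omega) (UU_mono h.2.2.2.2.1 (by omega) (by omega) le_rfl)
  have hfin : (Prod.snd '' ENO T).Finite := (VV_finite T).subset (by rw [hV]; exact Set.subset_insert _ _)
  rw [hV, Set.ncard_insert_of_notMem hnot hfin, Set.ncard_image_of_injOn hinj]

theorem app_get {α : Type*} (T : List α) (c : α) {k : ℕ} (h : k < T.length) :
    (T ++ [c])[k]? = T[k]? := List.getElem?_append_left h

theorem UU_of_append {α : Type*} {T : List α} {c : α} {l r : ℕ} (hlr : l ≤ r)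
    (hr : r ≤ T.length) (h : UU (T ++ [c]) l r) : UU T l r := by
  intro i hi hk
  refine h i (by simp; omega) (fun k hk' => ?_)
  rw [app_get T c (by omega), app_get T c (by omega)]
  exact hk k hk'

theorem suffix_of_not {α : Type*} {T : List α} {c : α} {l r : ℕ} (hlr : l ≤ r)
    (hr : r ≤ T.length) (h : UU T l r) (h' : ¬ UU (T ++ [c]) l r) :
    ∀ k, k < r - l → (T ++ [c])[T.length + 1 - (r - l) + k]? = T[l + k]? := by
  unfold UU at h'
  push Not at h'
  obtain ⟨i, hi, hk, hne⟩ := h'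
  simp only [List.length_append, List.length_singleton] at hi
  have hi' : i = T.length + 1 - (r - l) := by
    by_contra hc
    apply hne
    refine h i (by omega) (fun k hk' => ?_)
    rw [← app_get T c (by omega), ← app_get T c (by omega)]
    exact hk k hk'
  intro k hk'
  rw [← hi', ← app_get T c (by omega)]
  exact hk k hk'

theorem end_unique_aux {α : Type*} {T : List α} {c : α} {l₁ r₁ l₂ r₂ : ℕ}
    (h₁ : l₁ ≤ r₁) (g₁ : r₁ ≤ T.length) (u₁ : UU T l₁ r₁) (v₁ : ¬ UU (T ++ [c]) l₁ r₁)
    (h₂ : l₂ ≤ r₂) (g₂ : r₂ ≤ T.length) (u₂ : UU T l₂ r₂) (v₂ : ¬ UU (T ++ [c]) l₂ r₂)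
    (hle : r₁ - l₁ ≤ r₂ - l₂) : r₁ = r₂ := by
  have s₁ := suffix_of_not h₁ g₁ u₁ v₁
  have s₂ := suffix_of_not h₂ g₂ u₂ v₂
  have := u₁ (r₂ - (r₁ - l₁)) (by omega) (fun k hk => by
    rw [← s₁ k hk]
    have := s₂ ((r₂ - l₂) - (r₁ - l₁) + k) (by omega)
    rw [show T.length + 1 - (r₂ - l₂) + ((r₂ - l₂) - (r₁ - l₁) + k)
      = T.length + 1 - (r₁ - l₁) + k by omega] at this
    rw [this]
    congr 1; omega)
  omega

theorem end_unique {α : Type*} {T : List α} {c : α} {l₁ r₁ l₂ r₂ : ℕ}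
    (h₁ : l₁ ≤ r₁) (g₁ : r₁ ≤ T.length) (u₁ : UU T l₁ r₁) (v₁ : ¬ UU (T ++ [c]) l₁ r₁)
    (h₂ : l₂ ≤ r₂) (g₂ : r₂ ≤ T.length) (u₂ : UU T l₂ r₂) (v₂ : ¬ UU (T ++ [c]) l₂ r₂) :
    r₁ = r₂ := by
  rcases le_total (r₁ - l₁) (r₂ - l₂) with h | h
  · exact end_unique_aux h₁ g₁ u₁ v₁ h₂ g₂ u₂ v₂ h
  · exact (end_unique_aux h₂ g₂ u₂ v₂ h₁ g₁ u₁ v₁ h).symm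

theorem exists_end {α : Type*} (T : List α) (c : α) :
    ∃ s, ∀ l r, l ≤ r → r ≤ T.length → UU T l r → ¬ UU (T ++ [c]) l r → r = s := by
  by_cases h : ∃ l r, l ≤ r ∧ r ≤ T.length ∧ UU T l r ∧ ¬ UU (T ++ [c]) l r
  · obtain ⟨l, s, a, b, d, e⟩ := h
    exact ⟨s, fun l' r' a' b' d' e' => end_unique a' b' d' e' a b d e⟩
  · exact ⟨0, fun l' r' a' b' d' e' => absurd ⟨l', r', a', b', d', e'⟩ h⟩

/-- Appending one character changes the number of extended net occurrences by at
least `-1` and at most `2`; in particular, never by `-2`. -/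
theorem ENO_card_change {α : Type*} [DecidableEq α] (T : List α) (c : α)
    (hn : 2 < T.length) :
    (-1 : ℤ) ≤ ((ENO (T ++ [c])).ncard : ℤ) - ((ENO T).ncard : ℤ) ∧
    ((ENO (T ++ [c])).ncard : ℤ) - ((ENO T).ncard : ℤ) ≤ 2 := by
  have e1 := VV_ncard T (by omega)
  have e2 := VV_ncard (T ++ [c]) (by simp)
  obtain ⟨s, hs⟩ := exists_end T c
  have i1 : VV T ⊆ insert s (VV (T ++ [c])) := by
    rintro r ⟨hr, l, hlr, hu, hnu⟩
    by_cases h : UU (T ++ [c]) l r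
    · right
      exact ⟨by simp; omega, l, hlr, h, fun h' => hnu (UU_of_append (by omega) (by omega) h')⟩
    · left
      exact hs l r hlr.le hr hu h
  have i2 : VV (T ++ [c]) ⊆ insert (T.length + 1) (insert (s + 1) (VV T)) := by
    rintro r ⟨hr, l, hlr, hu, hnu⟩
    simp only [List.length_append, List.length_singleton] at hr
    by_cases hr' : r = T.length + 1
    · left; exact hr'
    · right
      by_cases h : UU T l (r - 1)
      · left
        have := hs l (r - 1) (by omega) (by omega) h hnu
        omega
      · right
        exact ⟨by omega, l, hlr, UU_of_append hlr.le (by omega) hu, h⟩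
  have c1 := Set.ncard_le_ncard i1 ((VV_finite _).insert _)
  have c2 := Set.ncard_le_ncard i2 (((VV_finite _).insert _).insert _)
  have d1 := Set.ncard_insert_le s (VV (T ++ [c]))
  have d2 := Set.ncard_insert_le (T.length + 1) (insert (s + 1) (VV T))
  have d3 := Set.ncard_insert_le (s + 1) (VV T)
  omega
end

section
/- Let T be a string of length n > 2 and let [i−1..h], [k..j+1] ∈ MUS(T) be two MUS occurrences with i−1 < k and h < j+1, that are consecutive in MUS(T), i.e., there is no element [s..t] ∈ MUS(T) with i ≤ s < k and h < t ≤ j. Then [i..j] is a net occurrence of the repeat u = T[i..j]: T[i..j] is repeating in T and both T[i−1..j] and T[i..j+1] are unique in T. -/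
open List

theorem window_shift {α : Type*} (X : List α) (L d L' : ℕ) (h : d + L' ≤ L) :
    ((X.take L).drop d).take L' = (X.drop d).take L' := by
  rw [List.drop_take, List.take_take]
  congr 1
  omega

theorem substr_len {α : Type*} (T : List α) (i j : ℕ) (hi : 1 ≤ i) (hij : i ≤ j + 1)
    (hj : j ≤ T.length) : (substr T i j).length = j + 1 - i := by
  simp [substr]
  omega

theorem countOcc_pos {α : Type*} [DecidableEq α] (T : List α) (i j : ℕ) (hi : 1 ≤ i)
    (hij : i ≤ j + 1) (hj : j ≤ T.length) : 1 ≤ countOcc T (substr T i j) := by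
  unfold countOcc
  rw [substr_len T i j hi hij hj, Nat.one_le_iff_ne_zero, ← Nat.pos_iff_ne_zero, Finset.card_pos]
  refine ⟨i - 1, ?_⟩
  simp only [Finset.mem_filter, Finset.mem_range]
  exact ⟨by omega, by omega, rfl⟩

theorem countOcc_mono {α : Type*} [DecidableEq α] (T : List α) (i j s t : ℕ) (hi : 1 ≤ i)
    (his : i ≤ s) (hst : s ≤ t + 1) (htj : t ≤ j) (hj : j ≤ T.length) :
    countOcc T (substr T i j) ≤ countOcc T (substr T s t) := by
  unfold countOcc
  rw [substr_len T i j hi (by omega) hj, substr_len T s t (by omega) hst (by omega)]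
  refine Finset.card_le_card_of_injOn (fun p => p + (s - i)) ?_ ?_
  · intro p hp
    simp only [Finset.coe_filter, Finset.mem_range, Set.mem_setOf_eq] at hp ⊢
    obtain ⟨h1, h2, h3⟩ := hp
    refine ⟨by omega, by omega, ?_⟩
    have h := congrArg (fun X => (X.drop (s - i)).take (t + 1 - s)) h3
    simp only [substr] at h ⊢
    rw [window_shift _ _ _ _ (by omega), window_shift _ _ _ _ (by omega),
      List.drop_drop, List.drop_drop] at h
    rw [h]
    congr 2
    omega
  · intro p _ q _ h
    simpa using h

theorem exists_MUS {α : Type*} [DecidableEq α] (T : List α) (hn : 2 < T.length) (m : ℕ) :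
    ∀ i j, 1 ≤ i → i ≤ j + 1 → j ≤ T.length → j + 1 - i = m → uniqueIn T (substr T i j) →
      ∃ s t, (s, t) ∈ MUS T ∧ i ≤ s ∧ t ≤ j := by
  induction m with
  | zero =>
    intro i j hi hij hj hm hu
    exfalso
    have : substr T i j = [] := by simp [substr, hm]
    rw [this] at hu
    simp [uniqueIn, countOcc, Finset.filter_true_of_mem, Nat.lt_succ_iff] at hu
    have h2 : (Finset.range (T.length + 1)).filter (fun x => x ≤ T.length)
        = Finset.range (T.length + 1) := by
      ext x; simp; try omega
    first
      | omega
      | (rw [h2] at hu; simp at hu; subst hu; simp at hn)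
      | (subst hu; simp at hn)
  | succ m ih =>
    intro i j hi hij hj hm hu
    by_cases ha : uniqueIn T (substr T (i + 1) j)
    · obtain ⟨s, t, h, h', h''⟩ := ih (i + 1) j (by omega) (by omega) hj (by omega) ha
      exact ⟨s, t, h, by omega, h''⟩
    by_cases hb : uniqueIn T (substr T i (j - 1))
    · obtain ⟨s, t, h, h', h''⟩ := ih i (j - 1) (by omega) (by omega) (by omega) (by omega) hb
      exact ⟨s, t, h, by omega, by omega⟩
    refine ⟨i, j, ⟨hi, by show i ≤ j; omega, hj, hu, ?_, ?_⟩, le_rfl, le_rfl⟩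
    · have := countOcc_pos T (i + 1) j (by omega) (by omega) hj
      unfold uniqueIn at ha
      show 2 ≤ _
      dsimp only
      omega
    · have := countOcc_pos T i (j - 1) (by omega) (by omega) (by omega)
      unfold uniqueIn at hb
      show 2 ≤ _
      dsimp only
      omega

/-- If `[i-1..h]` and `[k..j+1]` are consecutive MUSs in `T`, then `[i..j]` is a net
occurrence of the repeat `T[i..j]`. -/
theorem consecutive_MUS_net_occurrence {α : Type*} [DecidableEq α] (T : List α)
    (hn : 2 < T.length) (i h k j : ℕ)
    (h1 : (i - 1, h) ∈ MUS T) (h2 : (k, j + 1) ∈ MUS T)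
    (h3 : i - 1 < k) (h4 : h < j + 1)
    (h5 : ∀ s t, (s, t) ∈ MUS T → ¬ (i ≤ s ∧ s < k ∧ h < t ∧ t ≤ j)) :
    NetOcc T i j := by
  obtain ⟨a1, a2, a3, a4, a5, -⟩ := h1
  obtain ⟨b1, b2, b3, b4, -, b6⟩ := h2
  dsimp only at a1 a2 a3 a4 a5 b1 b2 b3 b4 b6
  have hi : i - 1 + 1 = i := by omega
  rw [hi] at a5
  rw [Nat.add_sub_cancel] at b6
  unfold uniqueIn at a4 b4
  unfold repeatingIn at a5 b6
  refine ⟨by omega, by omega, b3, ?_, ?_, ?_⟩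
  · by_contra hr
    have hp := countOcc_pos T i j (by omega) (by omega) (by omega)
    have hu : uniqueIn T (substr T i j) := by
      unfold repeatingIn at hr
      unfold uniqueIn
      omega
    obtain ⟨s, t, hm, hs, ht⟩ := exists_MUS T hn _ i j (by omega) (by omega) (by omega) rfl hu
    have hm' := hm
    obtain ⟨c1, c2, c3, c4, -, -⟩ := hm'
    dsimp only at c1 c2 c3 c4
    unfold uniqueIn at c4
    refine h5 s t hm ⟨hs, ?_, ?_, ht⟩
    · by_contra hk
      have := countOcc_mono T k j s t b1 (by omega) (by omega) ht (by omega)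
      omega
    · by_contra hk
      have := countOcc_mono T i h s t (by omega) hs (by omega) (by omega) a3
      omega
  · have hp := countOcc_pos T (i - 1) j (by omega) (by omega) (by omega)
    have := countOcc_mono T (i - 1) j (i - 1) h a1 le_rfl (by omega) (by omega) (by omega)
    unfold uniqueIn
    omega
  · have hp := countOcc_pos T i (j + 1) (by omega) (by omega) (by omega)
    have := countOcc_mono T i (j + 1) k (j + 1) (by omega) (by omega) (by omega) le_rfl b3
    unfold uniqueIn
    omega
end

section
/- A net occurrence cannot be contained in another net occurrence: if [i..j] and [i'..j'] are both net occurrences in a string T with i ≤ i' and j' ≤ j, then i = i' and j = j'. -/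
open List

theorem countOcc_mono_aux {α : Type*} [DecidableEq α] (T : List α) (a L b l : ℕ)
    (hab : a ≤ b) (hbl : b + l ≤ a + L) (hL : a + L ≤ T.length) :
    countOcc T ((T.drop a).take L) ≤ countOcc T ((T.drop b).take l) := by
  have e1 : ((T.drop a).take L).length = L := by simp; omega
  have e2 : ((T.drop b).take l).length = l := by simp; omega
  unfold countOcc
  rw [e1, e2]
  apply Finset.card_le_card_of_injOn (fun p => p + (b - a))
  · intro p hp
    simp only [Finset.coe_filter, Finset.mem_range, Set.mem_setOf_eq] at hp ⊢
    obtain ⟨_, hp2, hp3⟩ := hp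
    refine ⟨by omega, by omega, ?_⟩
    have h := congrArg (fun w => (w.drop (b - a)).take l) hp3
    simp only [List.drop_take, List.drop_drop, List.take_take] at h
    rw [show min l (L - (b - a)) = l by omega, show a + (b - a) = b by omega] at h
    exact h
  · intro p _ q _ h
    simp only at h
    omega

/-- A net occurrence cannot be contained in another net occurrence. -/
theorem net_occurrence_not_contained {α : Type*} [DecidableEq α] (T : List α)
    (i j i' j' : ℕ) (h1 : NetOcc T i j) (h2 : NetOcc T i' j')
    (h3 : i ≤ i') (h4 : j' ≤ j) : i = i' ∧ j = j' := by
  obtain ⟨a1, a2, a3, a4, _, _⟩ := h1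
  obtain ⟨b1, b2, b3, _, b5, b6⟩ := h2
  unfold repeatingIn substr at a4
  unfold uniqueIn substr at b5 b6
  constructor
  · by_contra hne
    have := countOcc_mono_aux T (i - 1) (j + 1 - i) (i' - 1 - 1) (j' + 1 - (i' - 1))
      (by omega) (by omega) (by omega)
    omega
  · by_contra hne
    have := countOcc_mono_aux T (i - 1) (j + 1 - i) (i' - 1) (j' + 1 + 1 - i')
      (by omega) (by omega) (by omega)
    omega
end

section
/- Two consecutive extended net occurrences overlap: if [h..j], [i..k] ∈ ENO(T) with h < i and there is no element [s..t] ∈ ENO(T) with h < s < i, then i ≤ j, i.e., the intervals [h..j] and [i..k] share at least one position. -/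
open List

theorem substr_length_aux {α : Type*} (T : List α) (a b : ℕ) (ha : 1 ≤ a) (hab : a ≤ b + 1)
    (hb : b ≤ T.length) : (substr T a b).length = b + 1 - a := by
  simp only [substr, List.length_take, List.length_drop]
  omega

theorem count_pos_aux {α : Type*} [DecidableEq α] (T : List α) (a b : ℕ) (ha : 1 ≤ a)
    (hab : a ≤ b + 1) (hb : b ≤ T.length) : 1 ≤ countOcc T (substr T a b) := by
  unfold countOcc
  apply Finset.card_pos.mpr
  refine ⟨a - 1, ?_⟩
  rw [Finset.mem_filter, substr_length_aux T a b ha hab hb]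
  refine ⟨Finset.mem_range.mpr (by omega), by omega, rfl⟩

theorem count_mono_aux {α : Type*} [DecidableEq α] (T : List α) (a' a b b' : ℕ) (ha : 1 ≤ a')
    (h1 : a' ≤ a) (hab : a ≤ b) (h2 : b ≤ b') (hb : b' ≤ T.length) :
    countOcc T (substr T a' b') ≤ countOcc T (substr T a b) := by
  unfold countOcc
  rw [substr_length_aux T a b (by omega) (by omega) (by omega),
    substr_length_aux T a' b' (by omega) (by omega) (by omega)]
  apply Finset.card_le_card_of_injOn (fun p => p + (a - a'))
  · intro p hp
    simp only [Finset.coe_filter, Finset.mem_range, Set.mem_setOf_eq] at hp ⊢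
    obtain ⟨hp1, hp2, hp3⟩ := hp
    refine ⟨by omega, by omega, ?_⟩
    have key := congrArg (fun l => (l.drop (a - a')).take (b + 1 - a)) hp3
    simp only [substr, List.drop_take, List.drop_drop, List.take_take] at key ⊢
    rw [show min (b + 1 - a) (b' + 1 - a' - (a - a')) = b + 1 - a by omega] at key
    rw [key]
    congr 2
    omega
  · intro x _ y _ hxy
    simpa using hxy

theorem unique_le_aux {α : Type*} [DecidableEq α] (T : List α) (a b : ℕ) (hT : 1 ≤ T.length)
    (hu : uniqueIn T (substr T a b)) : a ≤ b := by
  by_contra hlt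
  have he : substr T a b = [] := by
    simp only [substr]
    rw [show b + 1 - a = 0 by omega]; simp
  rw [he] at hu
  unfold uniqueIn countOcc at hu
  rw [Finset.filter_true_of_mem] at hu
  · simp at hu; simp [hu] at hT
  · intro x hx
    have := Finset.mem_range.mp hx
    simp; omega

theorem unique_mono_aux {α : Type*} [DecidableEq α] (T : List α) (a' a b b' : ℕ) (ha : 1 ≤ a')
    (h1 : a' ≤ a) (h2 : b ≤ b') (hb : b' ≤ T.length) (hT : 1 ≤ T.length)
    (hu : uniqueIn T (substr T a b)) : uniqueIn T (substr T a' b') := by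
  have hab := unique_le_aux T a b hT hu
  have h3 := count_mono_aux T a' a b b' ha h1 hab h2 hb
  have h4 := count_pos_aux T a' b' ha (by omega) hb
  unfold uniqueIn at *
  omega

/-- Two consecutive extended net occurrences overlap. -/
theorem consecutive_ENO_overlap {α : Type*} [DecidableEq α] (T : List α)
    (h i j k : ℕ) (ha : (h, j) ∈ ENO T) (hb : (i, k) ∈ ENO T) (hc : h < i)
    (hd : ∀ s t, (s, t) ∈ ENO T → ¬ (h < s ∧ s < i)) : i ≤ j := by
  obtain ⟨hj, h1, h2, h3, -, -, hu⟩ := ha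
  obtain ⟨hk, i1, i2, i3, -, iu, -⟩ := hb
  simp only [Nat.add_sub_cancel] at *
  rw [show j - 1 + 1 = j by omega] at hu h3
  rw [show k - 1 + 1 = k by omega] at i3
  have hT : 1 ≤ T.length := by omega
  have main : ∀ s, h + 1 ≤ s → s ≤ i → uniqueIn T (substr T s j) := by
    intro s hs
    induction s, hs using Nat.le_induction with
    | base => intro _; exact hu
    | succ s hs ih =>
      intro hsi
      have us := ih (by omega)
      have hsj := unique_le_aux T s j hT us
      by_contra hn
      have hex : ∃ t, j ≤ t ∧ uniqueIn T (substr T (s + 1) t) := by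
        by_cases hjk : j ≤ k - 1
        · exact ⟨k - 1, hjk, unique_mono_aux T (s + 1) i (k - 1) (k - 1) (by omega) hsi le_rfl
            (by omega) hT iu⟩
        · exact absurd (unique_mono_aux T (s + 1) i (k - 1) j (by omega) hsi (by omega)
            h3 hT iu) hn
      classical
      obtain ⟨t, ⟨htj, htu⟩, hmin⟩ : ∃ t, (j ≤ t ∧ uniqueIn T (substr T (s + 1) t)) ∧
          ∀ m < t, ¬ (j ≤ m ∧ uniqueIn T (substr T (s + 1) m)) :=
        ⟨Nat.find hex, Nat.find_spec hex, fun m hm => Nat.find_min hex hm⟩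
      have htj' : j < t := by
        rcases Nat.lt_or_ge j t with h | h
        · exact h
        · exact absurd ((show t = j by omega) ▸ htu) hn
      have htk : t ≤ T.length := by
        by_contra hlt
        by_cases hjk : j ≤ k - 1
        · exact hmin (k - 1) (by omega) ⟨hjk, unique_mono_aux T (s + 1) i (k - 1) (k - 1)
            (by omega) hsi le_rfl (by omega) hT iu⟩
        · exact hn (unique_mono_aux T (s + 1) i (k - 1) j (by omega) hsi (by omega) h3 hT iu)
      refine hd s t ⟨by simp only; omega, by simp only; omega, by simp only; omega,
        by simp only; omega, ?_, ?_, ?_⟩ ⟨by omega, by omega⟩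
      · have hp := count_pos_aux T (s + 1) (t - 1) (by omega) (by omega) (by omega)
        have hq := hmin (t - 1) (by omega)
        have hr : ¬ uniqueIn T (substr T (s + 1) (t - 1)) := fun hh => hq ⟨by omega, hh⟩
        unfold uniqueIn at hr
        unfold repeatingIn
        simp only
        omega
      · simp only [Nat.add_sub_cancel]
        exact unique_mono_aux T s s j (t - 1) (by omega) le_rfl (by omega) (by omega) hT us
      · simp only
        rw [show t - 1 + 1 = t by omega]
        exact htu
  exact unique_le_aux T i j hT (main i (by omega) le_rfl)
end

section
/- Let T be a string, c a character, and u a nonempty suffix of T such that u is unique in T but repeating in Tc. Then u = c^{|u|}, i.e., u consists solely of copies of the character c. -/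
open List

theorem cons_eq_append_replicate {α : Type*} (c : α) (v : List α) :
    ∀ a, v ++ [c] = a :: v → a = c ∧ v = List.replicate v.length c := by
  induction v with
  | nil => intro a h; simp at h; simp [h]
  | cons b w ih =>
    intro a h
    simp only [List.cons_append, List.cons.injEq] at h
    obtain ⟨hb, hw⟩ := ih b h.2
    refine ⟨h.1 ▸ hb, ?_⟩
    rw [List.length_cons, List.replicate_succ, ← hw, hb]

/-- If a nonempty suffix `u` of `T` is unique in `T` but repeating in `Tc`, then `u`
consists solely of copies of `c`. -/
theorem unique_suffix_repeating_replicate {α : Type*} [DecidableEq α] (T : List α)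
    (c : α) (u : List α) (h0 : u ≠ []) (h1 : u <:+ T)
    (h2 : uniqueIn T u) (h3 : repeatingIn (T ++ [c]) u) :
    u = List.replicate u.length c := by
  obtain ⟨s, rfl⟩ := h1
  have key : ((s ++ u ++ [c]).drop (s.length + 1)).take u.length = u := by
    by_contra hne
    have hle : countOcc (s ++ u ++ [c]) u ≤ countOcc (s ++ u) u := by
      unfold countOcc
      apply Finset.card_le_card
      intro i hi
      simp only [Finset.mem_filter, Finset.mem_range] at hi ⊢
      obtain ⟨hi1, hi2, hi3⟩ := hi
      have hi' : i ≠ s.length + 1 := by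
        rintro rfl
        exact hne hi3
      have hu : 0 < u.length := List.length_pos_iff.mpr h0
      simp only [List.length_append, List.length_singleton] at hi1 hi2 ⊢
      refine ⟨by omega, by omega, ?_⟩
      rw [List.drop_append_of_le_length (by simp only [List.length_append]; omega),
        List.take_append_of_le_length
          (by simp only [List.length_drop, List.length_append]; omega)] at hi3
      exact hi3
    unfold uniqueIn at h2
    unfold repeatingIn at h3
    omega
  cases u with
  | nil => exact absurd rfl h0
  | cons a v =>
    have e : (s ++ (a :: v) ++ [c]).drop (s.length + 1) = v ++ [c] := by
      rw [List.append_assoc, List.drop_append]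
      simp
    rw [e, List.take_of_length_le (by simp)] at key
    obtain ⟨ha, hv⟩ := cons_eq_append_replicate c v a key
    rw [List.length_cons, List.replicate_succ, ← hv, ha]
end
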